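/- arXiv:2403.04752 — 2 statements merged into one kernel-verified Lean document; each statement's English description precedes it below -/
import Mathlib

section
/- Suppose there exists γ* ∈ Γ₁ with A[γ*] ≻ 0 and Γ is polyhedral. Let (x,t) ∈ S_SDP satisfy 2t = sup_{γ∈Γ₁}[γ,q(x)] and let (1,f) ∈ relint(F(x,t)). Then R'(x,t) = {(x',t') ∈ ℝ^{n+1} : x' ∈ ker(A[f]) and ⟨b[γ], x'⟩ − t' = 0 for all γ with (1,γ) ∈ F(x,t)}. -/
noncomputable section
open Matrix Set

/-- Dot-product style inner product on `ℝ × (Fin m → ℝ)` (i.e. `ℝ^{1+m}`). -/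
def ipr {m : ℕ} (v w : ℝ × (Fin m → ℝ)) : ℝ := v.1 * w.1 + v.2 ⬝ᵥ w.2

/-- `A(γ₀, γ) = γ₀ A₀ + ∑ i, γ i • A i`. -/
def Amix {ι : Type*} [Fintype ι] {m : ℕ} (A0 : Matrix ι ι ℝ)
    (A : Fin m → Matrix ι ι ℝ) (g0 : ℝ) (g : Fin m → ℝ) : Matrix ι ι ℝ :=
  g0 • A0 + ∑ i, g i • A i

/-- `b(γ) = b₀ + ∑ i, γ i • b i` (the `γ₀ = 1` slice). -/
def bmix {ι : Type*} {m : ℕ} (b0 : ι → ℝ) (b : Fin m → ι → ℝ) (g : Fin m → ℝ) : ι → ℝ :=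
  b0 + ∑ i, g i • b i

/-- The cone of convex Lagrange multipliers `Γ`. -/
def Gamma {ι : Type*} [Fintype ι] {m : ℕ} (A0 : Matrix ι ι ℝ)
    (A : Fin m → Matrix ι ι ℝ) : Set (ℝ × (Fin m → ℝ)) :=
  {p | 0 ≤ p.1 ∧ (∀ i, 0 ≤ p.2 i) ∧ (Amix A0 A p.1 p.2).PosSemidef}

/-- The slice `Γ₁` of `Γ` at `γ₀ = 1`. -/
def Gamma1 {ι : Type*} [Fintype ι] {m : ℕ} (A0 : Matrix ι ι ℝ)
    (A : Fin m → Matrix ι ι ℝ) : Set (Fin m → ℝ) :=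
  {g | (∀ i, 0 ≤ g i) ∧ (Amix A0 A 1 g).PosSemidef}

/-- Polar cone with respect to `ipr`. -/
def polarCone {m : ℕ} (S : Set (ℝ × (Fin m → ℝ))) : Set (ℝ × (Fin m → ℝ)) :=
  {v | ∀ w ∈ S, ipr v w ≤ 0}

/-- The quadratic function `x ↦ xᵀ M x + 2 bᵀ x + c`. -/
def quadF {ι : Type*} [Fintype ι] (M : Matrix ι ι ℝ) (b : ι → ℝ) (c : ℝ) (x : ι → ℝ) : ℝ :=
  x ⬝ᵥ M.mulVec x + 2 * (b ⬝ᵥ x) + c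

/-- The vector `q(x) = (q₀(x), q₁(x), …, q_m(x)) ∈ ℝ^{1+m}`. -/
def qVec {ι : Type*} [Fintype ι] {m : ℕ} (A0 : Matrix ι ι ℝ) (b0 : ι → ℝ) (c0 : ℝ)
    (A : Fin m → Matrix ι ι ℝ) (b : Fin m → ι → ℝ) (c : Fin m → ℝ)
    (x : ι → ℝ) : ℝ × (Fin m → ℝ) :=
  (quadF A0 b0 c0 x, fun i => quadF (A i) (b i) (c i) x)

/-- The first unit vector `e₀ ∈ ℝ^{1+m}`. -/
def e0 {m : ℕ} : ℝ × (Fin m → ℝ) := (1, 0)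

/-- `[γ, q(x)] = q₀(x) + ∑ i, γ i * q i (x)`. -/
def brkt {ι : Type*} [Fintype ι] {m : ℕ} (A0 : Matrix ι ι ℝ) (b0 : ι → ℝ) (c0 : ℝ)
    (A : Fin m → Matrix ι ι ℝ) (b : Fin m → ι → ℝ) (c : Fin m → ℝ)
    (g : Fin m → ℝ) (x : ι → ℝ) : ℝ :=
  quadF A0 b0 c0 x + ∑ i, g i * quadF (A i) (b i) (c i) x

/-- The projected SDP relaxation `S_SDP = {(x,t) : q(x) - 2t e₀ ∈ Γ°}`. -/
def SSDP {ι : Type*} [Fintype ι] {m : ℕ} (A0 : Matrix ι ι ℝ) (b0 : ι → ℝ) (c0 : ℝ)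
    (A : Fin m → Matrix ι ι ℝ) (b : Fin m → ι → ℝ) (c : Fin m → ℝ) :
    Set ((ι → ℝ) × ℝ) :=
  {p | qVec A0 b0 c0 A b c p.1 - (2 * p.2) • e0 ∈ polarCone (Gamma A0 A)}

/-- The QCQP epigraph `S = {(x,t) : q₀(x) ≤ 2t, q i (x) ≤ 0 ∀ i}`. -/
def Sepi {ι : Type*} [Fintype ι] {m : ℕ} (A0 : Matrix ι ι ℝ) (b0 : ι → ℝ) (c0 : ℝ)
    (A : Fin m → Matrix ι ι ℝ) (b : Fin m → ι → ℝ) (c : Fin m → ℝ) :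
    Set ((ι → ℝ) × ℝ) :=
  {p | quadF A0 b0 c0 p.1 ≤ 2 * p.2 ∧ ∀ i, quadF (A i) (b i) (c i) p.1 ≤ 0}

/-- `F` is a face of the convex cone `K`. -/
def IsFaceOf {E : Type*} [Add E] (K F : Set E) : Prop :=
  F ⊆ K ∧ ∀ y ∈ K, ∀ z ∈ K, y + z ∈ F → y ∈ F ∧ z ∈ F

/-- `G` is the minimal face of `K` containing `v`. -/
def IsMinFace {E : Type*} [Add E] (K : Set E) (v : E) (G : Set E) : Prop :=
  IsFaceOf K G ∧ v ∈ G ∧ ∀ G', IsFaceOf K G' → v ∈ G' → G ⊆ G'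

/-- The set of rounding directions `R(x,t)` at a point `p` of a convex set `C`. -/
def Rset {E : Type*} [AddCommGroup E] [Module ℝ E] (C : Set E) (p : E) : Set E :=
  {d | ∃ ε : ℝ, 0 < ε ∧ ∀ s ∈ Set.Icc (-ε) ε, p + s • d ∈ C}

/-- The first-order rounding directions `R'(x,t)`, relative to a face `G` of `Γ°`. -/
def Rset' {ι : Type*} [Fintype ι] {m : ℕ} (A0 : Matrix ι ι ℝ) (b0 : ι → ℝ) (c0 : ℝ)
    (A : Fin m → Matrix ι ι ℝ) (b : Fin m → ι → ℝ) (c : Fin m → ℝ)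
    (x : ι → ℝ) (t : ℝ) (G : Set (ℝ × (Fin m → ℝ))) : Set ((ι → ℝ) × ℝ) :=
  {d | ∀ α : ℝ,
    qVec A0 b0 c0 A b c (x + α • d.1) - (2 * (t + α * d.2)) • e0 ∈ Submodule.span ℝ G}

/-- Orthogonal complement (as a set) of a subset of `ℝ^{1+m}` w.r.t. `ipr`. -/
def orthC {m : ℕ} (G : Set (ℝ × (Fin m → ℝ))) : Set (ℝ × (Fin m → ℝ)) :=
  {v | ∀ w ∈ G, ipr v w = 0}

lemma ipr_comm {m : ℕ} (v w : ℝ × (Fin m → ℝ)) : ipr v w = ipr w v := by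
  simp only [ipr, mul_comm, dotProduct_comm]

/-- `ipr` as a bilinear map. -/
def iprBilin (m : ℕ) : (ℝ × (Fin m → ℝ)) →ₗ[ℝ] (ℝ × (Fin m → ℝ)) →ₗ[ℝ] ℝ :=
  LinearMap.mk₂ ℝ ipr
    (fun u v w => by simp only [ipr, Prod.fst_add, Prod.snd_add, add_dotProduct]; ring)
    (fun r v w => by
      simp only [ipr, Prod.smul_fst, Prod.smul_snd, smul_dotProduct, smul_eq_mul]; ring)
    (fun u v w => by simp only [ipr, Prod.fst_add, Prod.snd_add, dotProduct_add]; ring)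
    (fun r v w => by
      simp only [ipr, Prod.smul_fst, Prod.smul_snd, dotProduct_smul, smul_eq_mul]; ring)

lemma iprBilin_apply {m : ℕ} (v w : ℝ × (Fin m → ℝ)) : iprBilin m v w = ipr v w := rfl

/-- **Farkas' lemma** for finitely many linear functionals. -/
lemma exists_nonneg_combination_of_forall_nonpos {V ι : Type*} [AddCommGroup V] [Module ℝ V]
    (s : Finset ι) (v : ι → Module.Dual ℝ V) (w : Module.Dual ℝ V)
    (h : ∀ p, (∀ i ∈ s, v i p ≤ 0) → w p ≤ 0) :
    ∃ c : ι → ℝ, (∀ i ∈ s, 0 ≤ c i) ∧ w = ∑ i ∈ s, c i • v i := by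
  classical
  induction s using Finset.induction_on generalizing v w with
  | empty =>
    refine ⟨0, by simp, LinearMap.ext fun p => ?_⟩
    have h₁ := h p (by simp)
    have h₂ := h (-p) (by simp)
    rw [map_neg] at h₂
    simpa using le_antisymm h₁ (by linarith)
  | insert a s ha ih =>
    by_cases hs : ∀ p, (∀ i ∈ s, v i p ≤ 0) → w p ≤ 0
    · obtain ⟨c, hc, rfl⟩ := ih v w hs
      have hne : ∀ i ∈ s, i ≠ a := fun i hi hia => ha (hia ▸ hi)
      refine ⟨Function.update c a 0, fun i hi => ?_, ?_⟩
      · rcases Finset.mem_insert.1 hi with rfl | hi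
        · simp
        · simpa [hne i hi] using hc i hi
      · rw [Finset.sum_insert ha, Function.update_self, zero_smul, zero_add]
        exact Finset.sum_congr rfl fun i hi => by rw [Function.update_of_ne (hne i hi)]
    push Not at hs
    obtain ⟨p, hp, hwp⟩ := hs
    have hap : 0 < v a p := by
      by_contra! hle
      refine absurd (h p fun i hi => ?_) hwp.not_ge
      rcases Finset.mem_insert.1 hi with rfl | hi
      exacts [hle, hp i hi]
    obtain ⟨c, hc, hw⟩ := ih (fun i => v i - (v i p / v a p) • v a)
      (w - (w p / v a p) • v a) (fun u hu => by
        have key := h (u - (v a u / v a p) • p) (fun i hi => by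
          rcases Finset.mem_insert.1 hi with rfl | hi
          · simp [div_mul_cancel₀ _ hap.ne']
          · have := hu i hi
            simp only [LinearMap.sub_apply, LinearMap.smul_apply, smul_eq_mul, map_sub,
              map_smul] at this ⊢
            convert this using 2
            ring)
        simp only [LinearMap.sub_apply, LinearMap.smul_apply, smul_eq_mul, map_sub,
          map_smul] at key ⊢
        convert key using 2
        ring)
    have hne : ∀ i ∈ s, i ≠ a := fun i hi hia => ha (hia ▸ hi)
    refine ⟨Function.update c a ((w p - ∑ i ∈ s, c i * v i p) / v a p), fun i hi => ?_, ?_⟩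
    · rcases Finset.mem_insert.1 hi with rfl | hi
      · rw [Function.update_self]
        have : ∑ j ∈ s, c j * v j p ≤ 0 :=
          Finset.sum_nonpos fun j hj => mul_nonpos_of_nonneg_of_nonpos (hc j hj) (hp j hj)
        exact div_nonneg (by linarith) hap.le
      · simpa [hne i hi] using hc i hi
    · have hupd : ∀ r : ℝ, ∑ i ∈ s, Function.update c a r i • v i = ∑ i ∈ s, c i • v i :=
        fun r => Finset.sum_congr rfl fun i hi => by rw [Function.update_of_ne (hne i hi)]
      rw [Finset.sum_insert ha, Function.update_self, hupd]
      ext u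
      have hwu := LinearMap.congr_fun hw u
      simp only [LinearMap.add_apply, LinearMap.smul_apply, LinearMap.sum_apply,
        LinearMap.sub_apply, smul_eq_mul, mul_sub, Finset.sum_sub_distrib] at hwu ⊢
      have : ∑ i ∈ s, c i * (v i p / v a p * v a u)
          = (∑ i ∈ s, c i * v i p) / v a p * v a u := by
        rw [Finset.sum_div, Finset.sum_mul]
        exact Finset.sum_congr rfl fun i _ => by ring
      rw [this] at hwu
      rw [eq_add_of_sub_eq hwu]
      ring

/-- For a polyhedral cone `K`, the polar of `K ∩ v₀^⊥` is `K° - ℝ₊ v₀`. -/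
lemma exists_add_smul_mem_polarCone {m : ℕ} {K : Set (ℝ × (Fin m → ℝ))}
    {s : Finset (ℝ × (Fin m → ℝ))} (hK : K = {p | ∀ v ∈ s, ipr v p ≤ 0})
    {v₀ w : ℝ × (Fin m → ℝ)} (hv₀ : v₀ ∈ polarCone K)
    (hw : ∀ p ∈ K, ipr p v₀ = 0 → ipr w p ≤ 0) :
    ∃ M : ℝ, 0 ≤ M ∧ w + M • v₀ ∈ polarCone K := by
  obtain ⟨c, hc, hcw⟩ := exists_nonneg_combination_of_forall_nonpos (Finset.insertNone s)
    (fun o => o.elim (-iprBilin m v₀) (iprBilin m)) (iprBilin m w) (fun p hp => by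
      have hpK : p ∈ K := by
        rw [hK]
        exact fun v hv => hp (some v) (Finset.some_mem_insertNone.2 hv)
      have h₁ : -ipr v₀ p ≤ 0 := hp none Finset.none_mem_insertNone
      have h₂ := hv₀ p hpK
      exact hw p hpK (by rw [ipr_comm]; linarith))
  refine ⟨c none, hc none Finset.none_mem_insertNone, fun p hp => ?_⟩
  have hwp := LinearMap.congr_fun hcw p
  simp only [Finset.sum_insertNone, Option.elim_none, Option.elim_some, LinearMap.add_apply,
    LinearMap.smul_apply, LinearMap.neg_apply, LinearMap.sum_apply, smul_eq_mul,
    iprBilin_apply] at hwp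
  rw [← iprBilin_apply, map_add, map_smul, LinearMap.add_apply, LinearMap.smul_apply,
    iprBilin_apply, iprBilin_apply, smul_eq_mul, hwp]
  rw [hK] at hp
  have : ∑ v ∈ s, c (some v) * ipr v p ≤ 0 := Finset.sum_nonpos fun v hv =>
    mul_nonpos_of_nonneg_of_nonpos (hc _ (Finset.some_mem_insertNone.2 hv)) (hp v hv)
  linarith

lemma add_smul_mem_polarCone {m : ℕ} {K : Set (ℝ × (Fin m → ℝ))}
    {u v : ℝ × (Fin m → ℝ)} (hu : u ∈ polarCone K) (hv : v ∈ polarCone K) {r : ℝ} (hr : 0 ≤ r) :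
    u + r • v ∈ polarCone K := by
  intro p hp
  rw [← iprBilin_apply, map_add, map_smul, LinearMap.add_apply, LinearMap.smul_apply,
    iprBilin_apply, iprBilin_apply, smul_eq_mul]
  have := mul_nonneg hr (neg_nonneg.2 (hv p hp))
  linarith [hu p hp]

lemma smul_mem_polarCone {m : ℕ} {K : Set (ℝ × (Fin m → ℝ))}
    {v : ℝ × (Fin m → ℝ)} (hv : v ∈ polarCone K) {r : ℝ} (hr : 0 ≤ r) :
    r • v ∈ polarCone K := by
  have h₀ : (0 : ℝ × (Fin m → ℝ)) ∈ polarCone K := fun p _ => by simp [ipr]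
  simpa using add_smul_mem_polarCone h₀ hv hr

/-- The span of the minimal face of the polar of a polyhedral cone `K` at `v₀` is the orthogonal
complement of the conjugate face `K ∩ v₀^⊥`. -/
lemma mem_span_minFace_polarCone_iff {m : ℕ} {K : Set (ℝ × (Fin m → ℝ))}
    {s : Finset (ℝ × (Fin m → ℝ))} (hK : K = {p | ∀ v ∈ s, ipr v p ≤ 0})
    {v₀ : ℝ × (Fin m → ℝ)} (hv₀ : v₀ ∈ polarCone K) {G : Set (ℝ × (Fin m → ℝ))}
    (hG : IsMinFace (polarCone K) v₀ G) (w : ℝ × (Fin m → ℝ)) :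
    w ∈ Submodule.span ℝ G ↔ ∀ p ∈ K, ipr p v₀ = 0 → ipr w p = 0 := by
  obtain ⟨⟨-, hface⟩, hv₀G, hmin⟩ := hG
  constructor
  · intro hw p hp hpv
    have hsub : G ⊆ {y | y ∈ polarCone K ∧ ipr y p = 0} := by
      refine hmin _ ⟨fun y hy => hy.1, fun y hy z hz hyz => ?_⟩ ⟨hv₀, by rw [ipr_comm, hpv]⟩
      have h := hyz.2
      rw [← iprBilin_apply, map_add, LinearMap.add_apply, iprBilin_apply, iprBilin_apply] at h
      have h₁ := hy p hp
      have h₂ := hz p hp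
      exact ⟨⟨hy, by linarith⟩, ⟨hz, by linarith⟩⟩
    have hle : Submodule.span ℝ G ≤ LinearMap.ker ((iprBilin m).flip p) :=
      Submodule.span_le.2 fun y hy => (hsub hy).2
    exact hle hw
  · intro hw
    obtain ⟨M₁, hM₁, h₁⟩ := exists_add_smul_mem_polarCone hK hv₀
      fun p hp hpv => (hw p hp hpv).le
    obtain ⟨M₂, hM₂, h₂⟩ := exists_add_smul_mem_polarCone (w := -w) hK hv₀ fun p hp hpv => by
      rw [← iprBilin_apply, map_neg, LinearMap.neg_apply, iprBilin_apply, hw p hp hpv, neg_zero]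
    obtain ⟨M, hM⟩ : ∃ M, M = M₁ + M₂ + 1 := ⟨_, rfl⟩
    have hM0 : 0 < M := by linarith
    have hy := smul_mem_polarCone (r := (2 * M)⁻¹)
      (add_smul_mem_polarCone h₁ hv₀ (r := M - M₁) (by linarith)) (by positivity)
    have hz := smul_mem_polarCone (r := (2 * M)⁻¹)
      (add_smul_mem_polarCone h₂ hv₀ (r := M - M₂) (by linarith)) (by positivity)
    obtain ⟨hyG, hzG⟩ := hface _ hy _ hz (by
      convert hv₀G using 1
      match_scalars <;> field_simp <;> ring)
    have hmem := Submodule.smul_mem _ M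
      (Submodule.sub_mem _ (Submodule.subset_span (R := ℝ) hyG) (Submodule.subset_span hzG))
    convert hmem using 1
    match_scalars <;> field_simp <;> ring

/-- A segment ending in a relative interior point can be prolonged within the set. -/
lemma exists_add_smul_sub_mem_of_mem_intrinsicInterior {E : Type*} [AddCommGroup E] [Module ℝ E]
    [TopologicalSpace E] [IsTopologicalAddGroup E] [ContinuousSMul ℝ E] {S : Set E} {z p : E}
    (hz : z ∈ intrinsicInterior ℝ S) (hp : p ∈ S) :
    ∃ ε : ℝ, 0 < ε ∧ z + ε • (z - p) ∈ S := by
  obtain ⟨y, hy, rfl⟩ := mem_intrinsicInterior.1 hz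
  have hmem : ∀ r : ℝ, (y : E) + r • ((y : E) - p) ∈ affineSpan ℝ S := fun r => by
    have := AffineSubspace.smul_vsub_vadd_mem (affineSpan ℝ S) r y.2
      (subset_affineSpan ℝ S hp) y.2
    simpa [add_comm] using this
  let φ : ℝ → affineSpan ℝ S := fun r => ⟨(y : E) + r • ((y : E) - p), hmem r⟩
  have hφ : Continuous φ := by
    refine Continuous.subtype_mk ?_ _
    fun_prop
  have hφ0 : φ 0 = y := Subtype.ext (by simp [φ])
  have hev : ∀ᶠ r in nhds (0 : ℝ), φ r ∈ interior ((↑) ⁻¹' S : Set (affineSpan ℝ S)) :=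
    hφ.continuousAt.eventually (by rw [hφ0]; exact isOpen_interior.mem_nhds hy)
  obtain ⟨δ, hδ, hball⟩ := Metric.eventually_nhds_iff.1 hev
  have hin := hball (y := δ / 2) (by
    rw [Real.dist_eq, sub_zero, abs_of_pos (by positivity)]
    linarith)
  have hin' : φ (δ / 2) ∈ ((↑) ⁻¹' S : Set (affineSpan ℝ S)) := interior_subset hin
  exact ⟨δ / 2, by positivity, hin'⟩

/-- The linear part of the Lagrangian with multiplier `p`. -/
def bHom {ι : Type*} {m : ℕ} (b0 : ι → ℝ) (b : Fin m → ι → ℝ)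
    (p : ℝ × (Fin m → ℝ)) : ι → ℝ :=
  p.1 • b0 + ∑ i, p.2 i • b i

lemma bHom_one {ι : Type*} {m : ℕ} (b0 : ι → ℝ) (b : Fin m → ι → ℝ) (g : Fin m → ℝ) :
    bHom b0 b (1, g) = bmix b0 b g := by
  simp [bHom, bmix]

lemma bHom_add {ι : Type*} {m : ℕ} (b0 : ι → ℝ) (b : Fin m → ι → ℝ)
    (p q : ℝ × (Fin m → ℝ)) : bHom b0 b (p + q) = bHom b0 b p + bHom b0 b q := by
  simp only [bHom, Prod.fst_add, Prod.snd_add, Pi.add_apply, add_smul, Finset.sum_add_distrib]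
  abel

lemma bHom_smul {ι : Type*} {m : ℕ} (b0 : ι → ℝ) (b : Fin m → ι → ℝ)
    (r : ℝ) (p : ℝ × (Fin m → ℝ)) : bHom b0 b (r • p) = r • bHom b0 b p := by
  simp only [bHom, Prod.smul_fst, Prod.smul_snd, Pi.smul_apply, smul_eq_mul, mul_smul, smul_add,
    Finset.smul_sum]

section Amix

variable {ι : Type*} [Fintype ι] {m : ℕ} (A0 : Matrix ι ι ℝ) (A : Fin m → Matrix ι ι ℝ)

lemma Amix_add (p q : ℝ × (Fin m → ℝ)) :
    Amix A0 A (p + q).1 (p + q).2 = Amix A0 A p.1 p.2 + Amix A0 A q.1 q.2 := by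
  simp only [Amix, Prod.fst_add, Prod.snd_add, Pi.add_apply, add_smul, Finset.sum_add_distrib]
  abel

lemma Amix_smul (r : ℝ) (p : ℝ × (Fin m → ℝ)) :
    Amix A0 A (r • p).1 (r • p).2 = r • Amix A0 A p.1 p.2 := by
  simp only [Amix, Prod.smul_fst, Prod.smul_snd, Pi.smul_apply, smul_eq_mul, mul_smul, smul_add,
    Finset.smul_sum]

variable {A0 A}

lemma Gamma_add {p q : ℝ × (Fin m → ℝ)} (hp : p ∈ Gamma A0 A) (hq : q ∈ Gamma A0 A) :
    p + q ∈ Gamma A0 A :=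
  ⟨add_nonneg hp.1 hq.1, fun i => add_nonneg (hp.2.1 i) (hq.2.1 i), by
    rw [Amix_add]
    exact hp.2.2.add hq.2.2⟩

lemma Gamma_smul {p : ℝ × (Fin m → ℝ)} (hp : p ∈ Gamma A0 A) {r : ℝ} (hr : 0 ≤ r) :
    r • p ∈ Gamma A0 A :=
  ⟨mul_nonneg hr hp.1, fun i => mul_nonneg hr (hp.2.1 i), by
    rw [Amix_smul]
    exact hp.2.2.smul hr⟩

lemma ipr_qVec_sub (b0 : ι → ℝ) (c0 : ℝ) (b : Fin m → ι → ℝ) (c : Fin m → ℝ) (x : ι → ℝ)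
    (t : ℝ) (p : ℝ × (Fin m → ℝ)) :
    ipr (qVec A0 b0 c0 A b c x - (2 * t) • e0) p =
      x ⬝ᵥ (Amix A0 A p.1 p.2) *ᵥ x + 2 * (bHom b0 b p ⬝ᵥ x)
        + (p.1 * c0 + p.2 ⬝ᵥ c) - 2 * t * p.1 := by
  have h : p.2 ⬝ᵥ (fun i => quadF (A i) (b i) (c i) x) =
      ∑ i, p.2 i * (x ⬝ᵥ A i *ᵥ x) + 2 * ∑ i, p.2 i * (b i ⬝ᵥ x) + p.2 ⬝ᵥ c := by
    rw [dotProduct, dotProduct, Finset.mul_sum, ← Finset.sum_add_distrib,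
      ← Finset.sum_add_distrib]
    refine Finset.sum_congr rfl fun i _ => ?_
    rw [quadF]
    ring
  simp only [ipr, qVec, e0, Amix, bHom, Prod.fst_sub, Prod.snd_sub, Prod.smul_fst, Prod.smul_snd,
    smul_zero, sub_zero, smul_eq_mul, add_mulVec, smul_mulVec, sum_mulVec, dotProduct_add,
    dotProduct_smul, dotProduct_sum, add_dotProduct, smul_dotProduct, sum_dotProduct]
  rw [dotProduct_comm _ p.2, h, quadF]
  ring

/-- Expansion of the Lagrangian along a line. -/
lemma ipr_qVec_add_smul_sub (b0 : ι → ℝ) (c0 : ℝ) (b : Fin m → ι → ℝ) (c : Fin m → ℝ)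
    (x y : ι → ℝ) (t u α : ℝ) {p : ℝ × (Fin m → ℝ)} (hp : p ∈ Gamma A0 A) :
    ipr (qVec A0 b0 c0 A b c (x + α • y) - (2 * (t + α * u)) • e0) p =
      ipr (qVec A0 b0 c0 A b c x - (2 * t) • e0) p
        + 2 * α * (x ⬝ᵥ (Amix A0 A p.1 p.2) *ᵥ y + bHom b0 b p ⬝ᵥ y - p.1 * u)
        + α ^ 2 * (y ⬝ᵥ (Amix A0 A p.1 p.2) *ᵥ y) := by
  have hsymm : y ⬝ᵥ (Amix A0 A p.1 p.2) *ᵥ x = x ⬝ᵥ (Amix A0 A p.1 p.2) *ᵥ y := by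
    have h : (Amix A0 A p.1 p.2)ᵀ = Amix A0 A p.1 p.2 := by
      simpa [IsHermitian, conjTranspose_eq_transpose_of_trivial] using hp.2.2.isHermitian
    rw [dotProduct_mulVec, ← mulVec_transpose, h, dotProduct_comm]
  rw [ipr_qVec_sub, ipr_qVec_sub]
  simp only [mulVec_add, mulVec_smul, dotProduct_add, add_dotProduct, dotProduct_smul,
    smul_dotProduct, smul_eq_mul, hsymm]
  ring

/-- The Lagrangian stays zero along a line iff the direction lies in the kernel of the quadratic
part and annihilates the linear part. -/
lemma forall_ipr_qVec_eq_zero_iff (b0 : ι → ℝ) (c0 : ℝ) (b : Fin m → ι → ℝ) (c : Fin m → ℝ)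
    (x y : ι → ℝ) (t u : ℝ) {p : ℝ × (Fin m → ℝ)} (hp : p ∈ Gamma A0 A)
    (hpx : ipr p (qVec A0 b0 c0 A b c x - (2 * t) • e0) = 0) :
    (∀ α : ℝ, ipr (qVec A0 b0 c0 A b c (x + α • y) - (2 * (t + α * u)) • e0) p = 0) ↔
      (Amix A0 A p.1 p.2) *ᵥ y = 0 ∧ bHom b0 b p ⬝ᵥ y - p.1 * u = 0 := by
  rw [ipr_comm] at hpx
  simp only [ipr_qVec_add_smul_sub b0 c0 b c x y t u _ hp, hpx, zero_add]
  constructor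
  · intro h
    have h₁ := h 1
    have h₂ := h (-1)
    have hy : (Amix A0 A p.1 p.2) *ᵥ y = 0 := by
      rw [← hp.2.2.dotProduct_mulVec_zero_iff, star_trivial]
      linarith
    rw [hy, dotProduct_zero, dotProduct_zero] at h₁
    exact ⟨hy, by linarith⟩
  · rintro ⟨hy, hb⟩ α
    rw [hy, dotProduct_zero, dotProduct_zero, zero_add, hb]
    ring

/-- If `z` is a relative interior point of a subset of `Γ`, the kernel of `A(z)` is contained in
all the kernels of `A(p)`. -/
lemma Amix_mulVec_eq_zero_of_mem_intrinsicInterior {S : Set (ℝ × (Fin m → ℝ))}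
    (hS : S ⊆ Gamma A0 A) {z p : ℝ × (Fin m → ℝ)} (hz : z ∈ intrinsicInterior ℝ S) (hp : p ∈ S)
    {y : ι → ℝ} (hy : (Amix A0 A z.1 z.2) *ᵥ y = 0) : (Amix A0 A p.1 p.2) *ᵥ y = 0 := by
  obtain ⟨ε, hε, hmem⟩ := exists_add_smul_sub_mem_of_mem_intrinsicInterior hz hp
  have h₁ := (hS hmem).2.2.dotProduct_mulVec_nonneg y
  have h₂ := (hS hp).2.2.dotProduct_mulVec_nonneg y
  rw [← (hS hp).2.2.dotProduct_mulVec_zero_iff]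
  rw [sub_eq_add_neg, ← neg_one_smul ℝ p, Amix_add, Amix_smul, Amix_add, Amix_smul, add_mulVec,
    smul_mulVec, add_mulVec, smul_mulVec, hy, zero_add, zero_add, dotProduct_smul,
    dotProduct_smul, smul_eq_mul, smul_eq_mul] at h₁
  nlinarith

end Amix

/-- when `Γ` is polyhedral, refined description of `R'(x,t)`. -/
theorem stmt17 {n m : ℕ} (A0 : Matrix (Fin n) (Fin n) ℝ) (b0 : Fin n → ℝ) (c0 : ℝ)
    (A : Fin m → Matrix (Fin n) (Fin n) ℝ) (b : Fin m → Fin n → ℝ) (c : Fin m → ℝ)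
    (hA0 : A0.IsSymm) (hA : ∀ i, (A i).IsSymm)
    (hdef : ∃ g ∈ Gamma1 A0 A, (Amix A0 A 1 g).PosDef)
    (hpoly : ∃ s : Finset (ℝ × (Fin m → ℝ)),
      Gamma A0 A = {p : ℝ × (Fin m → ℝ) | ∀ v ∈ s, ipr v p ≤ 0})
    (x : Fin n → ℝ) (t : ℝ) (hxt : (x, t) ∈ SSDP A0 b0 c0 A b c)
    (hsup : IsLUB ((fun g => brkt A0 b0 c0 A b c g x) '' Gamma1 A0 A) (2 * t))
    (f : Fin m → ℝ)
    (hf : ((1 : ℝ), f) ∈ intrinsicInterior ℝ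
      (Gamma A0 A ∩ {v | ipr v (qVec A0 b0 c0 A b c x - (2 * t) • e0) = 0}))
    (G : Set (ℝ × (Fin m → ℝ)))
    (hG : IsMinFace (polarCone (Gamma A0 A))
      (qVec A0 b0 c0 A b c x - (2 * t) • e0) G) :
    Rset' A0 b0 c0 A b c x t G =
      {d : (Fin n → ℝ) × ℝ | (Amix A0 A 1 f).mulVec d.1 = 0 ∧
        ∀ g : Fin m → ℝ,
          ((1 : ℝ), g) ∈ Gamma A0 A ∩
            {v | ipr v (qVec A0 b0 c0 A b c x - (2 * t) • e0) = 0} →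
          bmix b0 b g ⬝ᵥ d.1 - d.2 = 0} := by
  obtain ⟨s, hs⟩ := hpoly
  have hfF := intrinsicInterior_subset hf
  have hmem : ∀ d, d ∈ Rset' A0 b0 c0 A b c x t G ↔ ∀ p ∈ Gamma A0 A,
      ipr p (qVec A0 b0 c0 A b c x - (2 * t) • e0) = 0 →
        (Amix A0 A p.1 p.2) *ᵥ d.1 = 0 ∧ bHom b0 b p ⬝ᵥ d.1 - p.1 * d.2 = 0 := by
    intro d
    simp only [Rset', mem_ofPred_eq, mem_span_minFace_polarCone_iff hs hxt hG]
    refine ⟨fun h p hp hpx => ?_, fun h α p hp hpx => ?_⟩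
    · exact (forall_ipr_qVec_eq_zero_iff b0 c0 b c x d.1 t d.2 hp hpx).1 fun α => h α p hp hpx
    · exact (forall_ipr_qVec_eq_zero_iff b0 c0 b c x d.1 t d.2 hp hpx).2 (h p hp hpx) α
  ext d
  rw [hmem, mem_ofPred_eq]
  constructor
  · intro h
    refine ⟨(h _ hfF.1 hfF.2).1, fun g hg => ?_⟩
    simpa only [bHom_one, one_mul] using (h _ hg.1 hg.2).2
  · rintro ⟨hd, hb⟩ p hp hpx
    refine ⟨Amix_mulVec_eq_zero_of_mem_intrinsicInterior inter_subset_left hf ⟨hp, hpx⟩ hd, ?_⟩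
    have hpos : 0 < 1 + p.1 := by linarith [hp.1]
    have hnorm : ((1 : ℝ), (1 + p.1)⁻¹ • (f + p.2)) = (1 + p.1)⁻¹ • (((1 : ℝ), f) + p) := by
      refine Prod.ext ?_ rfl
      simp [inv_mul_cancel₀ hpos.ne', ← mul_one_add]
    have hsum := hb ((1 + p.1)⁻¹ • (f + p.2)) (by
      rw [hnorm]
      refine ⟨Gamma_smul (Gamma_add hfF.1 hp) (by positivity), ?_⟩
      have h₁ := hfF.2
      simp only [mem_ofPred_eq, ← iprBilin_apply, map_smul, map_add, LinearMap.smul_apply,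
        LinearMap.add_apply] at h₁ hpx ⊢
      rw [h₁, hpx, add_zero, smul_zero])
    have hone := hb f hfF
    rw [← bHom_one, hnorm, bHom_smul, bHom_add, smul_dotProduct, add_dotProduct, bHom_one,
      smul_eq_mul, sub_eq_zero, inv_mul_eq_iff_eq_mul₀ hpos.ne'] at hsum
    linarith
end
end

section
/- (Quadratic matrix programs) Suppose each Aᵢ = I_k ⊗ 𝔸ᵢ for matrices 𝔸ᵢ ∈ 𝕊^r (i ∈ {0,1,…,m}), there exists γ* ∈ ℝ₊^m with A[γ*] ≻ 0, and k ≥ m. Then for every (x,t) ∈ S_SDP \ S the subspace R'(x,t) contains a nonzero vector, and consequently conv(S) = S_SDP. -/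
noncomputable section
open Matrix Set

/-- The vector `(yᵀ A₀ y, yᵀ A₁ y, …, yᵀ A_m y)` of homogeneous quadratic forms. -/
def quadVec {ι : Type*} [Fintype ι] {m : ℕ} (A0 : Matrix ι ι ℝ) (A : Fin m → Matrix ι ι ℝ)
    (y : ι → ℝ) : ℝ × (Fin m → ℝ) :=
  (y ⬝ᵥ A0 *ᵥ y, fun i => y ⬝ᵥ A i *ᵥ y)

/-- The vector `w ⊗ y`. -/
def tensorVec {k r : ℕ} (w : Fin k → ℝ) (y : Fin r → ℝ) : Fin k × Fin r → ℝ :=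
  fun p => w p.1 * y p.2

section Inner

variable {m : ℕ}

theorem ipr_add_left (u v w : ℝ × (Fin m → ℝ)) : ipr (u + v) w = ipr u w + ipr v w := by
  simp only [ipr, Prod.fst_add, Prod.snd_add, add_dotProduct]; ring

theorem ipr_smul_left (a : ℝ) (v w : ℝ × (Fin m → ℝ)) : ipr (a • v) w = a * ipr v w := by
  simp only [ipr, Prod.smul_fst, Prod.smul_snd, smul_dotProduct, smul_eq_mul]; ring

theorem ipr_neg_left (v w : ℝ × (Fin m → ℝ)) : ipr (-v) w = -ipr v w := by
  rw [← neg_one_smul ℝ v, ipr_smul_left]; ring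

theorem ipr_sub_left (u v w : ℝ × (Fin m → ℝ)) : ipr (u - v) w = ipr u w - ipr v w := by
  rw [sub_eq_add_neg, ipr_add_left, ipr_neg_left]; ring

theorem ipr_sum_left {α : Type*} (s : Finset α) (f : α → ℝ × (Fin m → ℝ))
    (w : ℝ × (Fin m → ℝ)) : ipr (∑ j ∈ s, f j) w = ∑ j ∈ s, ipr (f j) w := by
  classical
  induction s using Finset.induction_on with
  | empty => simp [ipr]
  | insert a s ha ih => rw [Finset.sum_insert ha, Finset.sum_insert ha, ipr_add_left, ih]

theorem ipr_nonneg {v w : ℝ × (Fin m → ℝ)} (hv : 0 ≤ v) (hw0 : 0 ≤ w.1)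
    (hw : ∀ i, 0 ≤ w.2 i) : 0 ≤ ipr v w :=
  add_nonneg (mul_nonneg hv.1 hw0)
    (Finset.sum_nonneg fun i _ => mul_nonneg (hv.2 i) (hw i))

theorem continuous_ipr_left (w : ℝ × (Fin m → ℝ)) : Continuous fun v => ipr v w := by
  unfold ipr dotProduct
  fun_prop

theorem exists_ipr_eq (f : (ℝ × (Fin m → ℝ)) →L[ℝ] ℝ) :
    ∃ g : ℝ × (Fin m → ℝ), ∀ v, f v = ipr v g := by
  refine ⟨(f (1, 0), fun i => f (0, Pi.single i 1)), fun v => ?_⟩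
  have hv : v = v.1 • ((1, 0) : ℝ × (Fin m → ℝ)) +
      ∑ i, v.2 i • ((0, Pi.single i 1) : ℝ × (Fin m → ℝ)) := by
    ext j
    · simp [Prod.fst_sum]
    · simp [Prod.snd_sum, Finset.sum_apply, Pi.single_apply]
  conv_lhs => rw [hv]
  simp only [map_add, map_sum, map_smul, smul_eq_mul, ipr, dotProduct]

end Inner

section Quadratic

variable {ι : Type*} [Fintype ι] {m : ℕ}

theorem ipr_quadVec (A0 : Matrix ι ι ℝ) (A : Fin m → Matrix ι ι ℝ) (y : ι → ℝ)
    (f : ℝ × (Fin m → ℝ)) :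
    ipr (quadVec A0 A y) f = y ⬝ᵥ Amix A0 A f.1 f.2 *ᵥ y := by
  simp only [ipr, quadVec, Amix, add_mulVec, smul_mulVec, dotProduct_add, dotProduct_smul,
    smul_eq_mul, sum_mulVec, dotProduct_sum]
  rw [mul_comm]
  congr 1
  exact Finset.sum_congr rfl fun i _ => mul_comm _ _

theorem quadVec_smul (A0 : Matrix ι ι ℝ) (A : Fin m → Matrix ι ι ℝ) (a : ℝ) (y : ι → ℝ) :
    quadVec A0 A (a • y) = a ^ 2 • quadVec A0 A y := by
  ext <;> simp [quadVec, mulVec_smul] <;> ring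

theorem continuous_quadVec (A0 : Matrix ι ι ℝ) (A : Fin m → Matrix ι ι ℝ) :
    Continuous (quadVec A0 A) := by
  unfold quadVec mulVec dotProduct
  fun_prop

theorem Amix_isSymm {A0 : Matrix ι ι ℝ} {A : Fin m → Matrix ι ι ℝ} (hA0 : A0.IsSymm)
    (hA : ∀ i, (A i).IsSymm) (g0 : ℝ) (g : Fin m → ℝ) : (Amix A0 A g0 g).IsSymm := by
  unfold Amix Matrix.IsSymm
  simp only [transpose_add, transpose_smul, transpose_sum, hA0.eq, (hA _).eq]

theorem quadF_add_smul {M : Matrix ι ι ℝ} (hM : M.IsSymm) (b : ι → ℝ) (c : ℝ) (x z : ι → ℝ)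
    (a : ℝ) :
    quadF M b c (x + a • z) =
      quadF M b c x + 2 * a * ((M *ᵥ x + b) ⬝ᵥ z) + a ^ 2 * (z ⬝ᵥ M *ᵥ z) := by
  have h : x ⬝ᵥ M *ᵥ z = M *ᵥ x ⬝ᵥ z := by
    rw [dotProduct_mulVec, ← mulVec_transpose, hM.eq]
  simp only [quadF, mulVec_add, mulVec_smul, dotProduct_add, add_dotProduct, dotProduct_smul,
    smul_dotProduct, smul_eq_mul, h, dotProduct_comm z (M *ᵥ x)]
  ring

theorem quadF_combo (M : Matrix ι ι ℝ) (b : ι → ℝ) (c : ℝ) (x z : ι → ℝ) {s t : ℝ}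
    (hst : s + t = 1) :
    quadF M b c (s • x + t • z) =
      s * quadF M b c x + t * quadF M b c z - s * t * ((x - z) ⬝ᵥ M *ᵥ (x - z)) := by
  obtain rfl : t = 1 - s := by linarith
  simp only [quadF, mulVec_add, mulVec_sub, mulVec_smul, dotProduct_add, add_dotProduct,
    dotProduct_sub, sub_dotProduct, dotProduct_smul, smul_dotProduct, smul_eq_mul]
  ring

theorem mem_Sepi_iff (A0 : Matrix ι ι ℝ) (b0 : ι → ℝ) (c0 : ℝ) (A : Fin m → Matrix ι ι ℝ)
    (b : Fin m → ι → ℝ) (c : Fin m → ℝ) (p : (ι → ℝ) × ℝ) :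
    p ∈ Sepi A0 b0 c0 A b c ↔ qVec A0 b0 c0 A b c p.1 - (2 * p.2) • e0 ≤ 0 := by
  simp [Sepi, qVec, e0, Prod.le_def, Pi.le_def]

theorem Sepi_subset_SSDP (A0 : Matrix ι ι ℝ) (b0 : ι → ℝ) (c0 : ℝ) (A : Fin m → Matrix ι ι ℝ)
    (b : Fin m → ι → ℝ) (c : Fin m → ℝ) : Sepi A0 b0 c0 A b c ⊆ SSDP A0 b0 c0 A b c := by
  intro p hp f hf
  rw [mem_Sepi_iff] at hp
  have h := ipr_nonneg (neg_nonneg.2 hp) hf.1 hf.2.1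
  rw [ipr_neg_left] at h
  linarith

theorem convex_SSDP (A0 : Matrix ι ι ℝ) (b0 : ι → ℝ) (c0 : ℝ) (A : Fin m → Matrix ι ι ℝ)
    (b : Fin m → ι → ℝ) (c : Fin m → ℝ) : Convex ℝ (SSDP A0 b0 c0 A b c) := by
  intro p hp q hq s t hs ht hst f hf
  have h : qVec A0 b0 c0 A b c (s • p + t • q).1 - (2 * (s • p + t • q).2) • e0 =
      s • (qVec A0 b0 c0 A b c p.1 - (2 * p.2) • e0) +
        t • (qVec A0 b0 c0 A b c q.1 - (2 * q.2) • e0) -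
        (s * t) • quadVec A0 A (p.1 - q.1) := by
    ext
    · simp [qVec, quadVec, e0, quadF_combo _ _ _ _ _ hst]; ring
    · simp [qVec, quadVec, e0, quadF_combo _ _ _ _ _ hst]
  rw [h, ipr_sub_left, ipr_add_left, ipr_smul_left, ipr_smul_left, ipr_smul_left, ipr_quadVec]
  have h1 := mul_nonneg (mul_nonneg hs ht) (hf.2.2.dotProduct_mulVec_nonneg (p.1 - q.1))
  rw [star_trivial] at h1
  have h2 := mul_nonpos_of_nonneg_of_nonpos hs (hp f hf)
  have h3 := mul_nonpos_of_nonneg_of_nonpos ht (hq f hf)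
  linarith

end Quadratic

section Gram

variable {r m : ℕ}

theorem sum_dotProduct_mulVec_rows (M : Matrix (Fin r) (Fin r) ℝ)
    (B : Matrix (Fin r) (Fin r) ℝ) :
    ∑ j, B j ⬝ᵥ M *ᵥ B j = (M * (Bᴴ * B)).trace := by
  have h : (M * (Bᴴ * B)).trace = (B * M * Bᴴ).trace := by
    rw [← Matrix.mul_assoc, trace_mul_comm, ← Matrix.mul_assoc]
  rw [h, Matrix.trace]
  refine Finset.sum_congr rfl fun j _ => ?_
  rw [diag_apply, Matrix.mul_assoc]
  simp only [Matrix.mul_apply, dotProduct, mulVec, conjTranspose_apply, star_trivial]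

/-- The cone of all `(⟨A₀, Z⟩, …, ⟨A_m, Z⟩) + s` with `Z = BᵀB` positive semidefinite, `s ≥ 0`. -/
def gramCone (A0 : Matrix (Fin r) (Fin r) ℝ) (A : Fin m → Matrix (Fin r) (Fin r) ℝ) :
    Set (ℝ × (Fin m → ℝ)) :=
  {v | ∃ (B : Fin r → Fin r → ℝ) (s : ℝ × (Fin m → ℝ)), 0 ≤ s ∧
    v = ∑ j, quadVec A0 A (B j) + s}

variable {A0 : Matrix (Fin r) (Fin r) ℝ} {A : Fin m → Matrix (Fin r) (Fin r) ℝ}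

open scoped MatrixOrder Matrix.Norms.L2Operator in
theorem gramCone_add {u v : ℝ × (Fin m → ℝ)} (hu : u ∈ gramCone A0 A)
    (hv : v ∈ gramCone A0 A) : u + v ∈ gramCone A0 A := by
  obtain ⟨B, s, hs, rfl⟩ := hu
  obtain ⟨B', s', hs', rfl⟩ := hv
  have hpsd : ((of B)ᴴ * of B + (of B')ᴴ * of B').PosSemidef :=
    (posSemidef_conjTranspose_mul_self _).add (posSemidef_conjTranspose_mul_self _)
  obtain ⟨D, hD⟩ := CStarAlgebra.nonneg_iff_eq_star_mul_self.1 hpsd.nonneg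
  rw [star_eq_conjTranspose] at hD
  have key : ∀ M : Matrix (Fin r) (Fin r) ℝ,
      ∑ j, B j ⬝ᵥ M *ᵥ B j + ∑ j, B' j ⬝ᵥ M *ᵥ B' j = ∑ j, D j ⬝ᵥ M *ᵥ D j := by
    intro M
    rw [sum_dotProduct_mulVec_rows M D, ← hD, Matrix.mul_add, trace_add,
      ← sum_dotProduct_mulVec_rows, ← sum_dotProduct_mulVec_rows]
    rfl
  refine ⟨D, s + s', add_nonneg hs hs', ?_⟩
  rw [add_add_add_comm]
  congr 1
  ext i
  · simpa [quadVec, Prod.fst_sum] using key A0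
  · simpa [quadVec, Prod.snd_sum, Finset.sum_apply] using key (A i)

theorem gramCone_smul {v : ℝ × (Fin m → ℝ)} (hv : v ∈ gramCone A0 A) {a : ℝ} (ha : 0 ≤ a) :
    a • v ∈ gramCone A0 A := by
  obtain ⟨B, s, hs, rfl⟩ := hv
  refine ⟨fun j => √a • B j, a • s, smul_nonneg ha hs, ?_⟩
  simp only [quadVec_smul, Real.sq_sqrt ha, smul_add, Finset.smul_sum]

theorem convex_gramCone : Convex ℝ (gramCone A0 A) :=
  fun _ hu _ hv _ _ hs ht _ => gramCone_add (gramCone_smul hu hs) (gramCone_smul hv ht)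

theorem quadVec_mem_gramCone (y : Fin r → ℝ) : quadVec A0 A y ∈ gramCone A0 A := by
  rcases r with _ | r
  · refine ⟨0, 0, le_rfl, ?_⟩
    ext <;> simp [quadVec]
  · refine ⟨Pi.single 0 y, 0, le_rfl, ?_⟩
    rw [add_zero, Finset.sum_eq_single 0]
    · simp
    · intro j _ hj
      rw [Pi.single_eq_of_ne hj]
      ext <;> simp [quadVec]
    · simp

theorem mem_gramCone_of_nonneg {s : ℝ × (Fin m → ℝ)} (hs : 0 ≤ s) : s ∈ gramCone A0 A := by
  refine ⟨0, s, hs, ?_⟩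
  have : quadVec A0 A 0 = 0 := by ext <;> simp [quadVec]
  simp [this]

theorem exists_pos_mul_sq_norm_le {M : Matrix (Fin r) (Fin r) ℝ} (hM : M.PosDef) :
    ∃ δ : ℝ, 0 < δ ∧ ∀ y : Fin r → ℝ, δ * ‖y‖ ^ 2 ≤ y ⬝ᵥ M *ᵥ y := by
  have hcont : Continuous fun y : Fin r → ℝ => y ⬝ᵥ M *ᵥ y := by
    unfold mulVec dotProduct
    fun_prop
  by_cases hne : (Metric.sphere (0 : Fin r → ℝ) 1).Nonempty
  · obtain ⟨z, hz, hmin⟩ := (isCompact_sphere (0 : Fin r → ℝ) 1).exists_isMinOn hne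
      hcont.continuousOn
    have hz0 : z ≠ 0 := by
      rintro rfl
      simp at hz
    refine ⟨z ⬝ᵥ M *ᵥ z, by simpa using hM.dotProduct_mulVec_pos hz0, fun y => ?_⟩
    rcases eq_or_ne y 0 with rfl | hy
    · simp
    have hy' : ‖y‖ ≠ 0 := norm_ne_zero_iff.2 hy
    have h := hmin (show ‖y‖⁻¹ • y ∈ Metric.sphere (0 : Fin r → ℝ) 1 by
      simp [norm_smul, hy'])
    simp only [mulVec_smul, dotProduct_smul, smul_dotProduct, smul_eq_mul, Set.mem_ofPred_eq] at h
    calc (z ⬝ᵥ M *ᵥ z) * ‖y‖ ^ 2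
        ≤ (‖y‖⁻¹ * (‖y‖⁻¹ * (y ⬝ᵥ M *ᵥ y))) * ‖y‖ ^ 2 := by gcongr
      _ = y ⬝ᵥ M *ᵥ y := by field_simp
  · refine ⟨1, one_pos, fun y => ?_⟩
    rcases eq_or_ne y 0 with rfl | hy
    · simp
    exact absurd ⟨‖y‖⁻¹ • y, by simp [norm_smul, norm_ne_zero_iff.2 hy]⟩ hne

theorem isClosed_gramCone {g : ℝ × (Fin m → ℝ)} (hg0 : 0 ≤ g.1) (hg : ∀ i, 0 ≤ g.2 i)
    (hpd : (Amix A0 A g.1 g.2).PosDef) : IsClosed (gramCone A0 A) := by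
  obtain ⟨δ, hδ, hle⟩ := exists_pos_mul_sq_norm_le hpd
  refine isClosed_of_closure_subset fun v hv => ?_
  have hQ : Continuous fun B : Fin r → Fin r → ℝ => ∑ j, quadVec A0 A (B j) :=
    continuous_finsetSum _ fun j _ => (continuous_quadVec A0 A).comp (continuous_apply j)
  obtain ⟨K, hK⟩ := (isCompact_closedBall v 1).bddAbove_image
    (continuous_ipr_left g).continuousOn
  have hK' : ∀ u ∈ Metric.ball v 1, ipr u g ≤ K := fun u hu =>
    hK (mem_image_of_mem _ (Metric.ball_subset_closedBall hu))
  set R : ℝ := √(K / δ) with hR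
  obtain ⟨L, hL⟩ := (isCompact_closedBall (0 : Fin r → Fin r → ℝ) R).bddAbove_image
    hQ.norm.continuousOn
  let W : Set ((Fin r → Fin r → ℝ) × (ℝ × (Fin m → ℝ))) :=
    Metric.closedBall 0 R ×ˢ (Metric.closedBall 0 (‖v‖ + 1 + L) ∩ Set.Ici 0)
  have hW : IsCompact W := (isCompact_closedBall _ _).prod
    ((isCompact_closedBall _ _).inter_right isClosed_Ici)
  have himg := (hW.image (f := fun p => ∑ j, quadVec A0 A (p.1 j) + p.2)
    ((hQ.comp continuous_fst).add continuous_snd)).isClosed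
  have hsub : Metric.ball v 1 ∩ gramCone A0 A ⊆
      (fun p : (Fin r → Fin r → ℝ) × (ℝ × (Fin m → ℝ)) =>
        ∑ j, quadVec A0 A (p.1 j) + p.2) '' W := by
    rintro u ⟨hu, B, s, hs, rfl⟩
    have h1 := hK' _ hu
    rw [ipr_add_left, ipr_sum_left] at h1
    simp only [ipr_quadVec] at h1
    have h2 := ipr_nonneg hs hg0 hg
    have hB : ‖B‖ ≤ R := by
      refine (pi_norm_le_iff_of_nonneg (Real.sqrt_nonneg _)).2 fun j => ?_
      refine Real.le_sqrt_of_sq_le ?_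
      rw [le_div_iff₀ hδ, mul_comm]
      refine (hle (B j)).trans ?_
      have h3 : B j ⬝ᵥ Amix A0 A g.1 g.2 *ᵥ B j ≤
          ∑ j, B j ⬝ᵥ Amix A0 A g.1 g.2 *ᵥ B j :=
        Finset.single_le_sum (f := fun j => B j ⬝ᵥ Amix A0 A g.1 g.2 *ᵥ B j)
          (fun j _ => (by positivity : 0 ≤ δ * ‖B j‖ ^ 2).trans (hle (B j)))
          (Finset.mem_univ j)
      linarith
    have hB' : B ∈ Metric.closedBall (0 : Fin r → Fin r → ℝ) R := by simpa using hB
    refine ⟨(B, s), ⟨hB', ?_, hs⟩, rfl⟩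
    have h4 : ‖∑ j, quadVec A0 A (B j)‖ ≤ L := hL (mem_image_of_mem _ hB')
    have h5 : ‖∑ j, quadVec A0 A (B j) + s‖ ≤ ‖v‖ + 1 := by
      have := norm_sub_norm_le (∑ j, quadVec A0 A (B j) + s) v
      rw [Metric.mem_ball, dist_eq_norm] at hu
      linarith
    have h6 := norm_sub_le (∑ j, quadVec A0 A (B j) + s) (∑ j, quadVec A0 A (B j))
    rw [add_sub_cancel_left] at h6
    rw [mem_closedBall_zero_iff]
    linarith
  have hv' : v ∈ closure (Metric.ball v 1 ∩ gramCone A0 A) :=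
    Metric.isOpen_ball.inter_closure ⟨Metric.mem_ball_self one_pos, hv⟩
  obtain ⟨⟨B, s⟩, ⟨-, -, hs⟩, rfl⟩ := closure_minimal hsub himg hv'
  exact ⟨B, s, hs, rfl⟩

/-- Conic duality: under strict feasibility, `Γ° = -gramCone`. -/
theorem neg_mem_gramCone_of_mem_polarCone (hA0 : A0.IsSymm) (hA : ∀ i, (A i).IsSymm)
    {g : ℝ × (Fin m → ℝ)} (hg0 : 0 ≤ g.1) (hg : ∀ i, 0 ≤ g.2 i)
    (hpd : (Amix A0 A g.1 g.2).PosDef) {v : ℝ × (Fin m → ℝ)}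
    (hv : v ∈ polarCone (Gamma A0 A)) : -v ∈ gramCone A0 A := by
  by_contra hnot
  obtain ⟨f, u, hfu, hfc⟩ := geometric_hahn_banach_point_closed
    (convex_gramCone (A0 := A0) (A := A)) (isClosed_gramCone hg0 hg hpd) hnot
  obtain ⟨h, hh⟩ := exists_ipr_eq f
  simp only [hh] at hfu hfc
  have hu : u < 0 := by simpa [ipr] using hfc 0 (mem_gramCone_of_nonneg le_rfl)
  have hpos : ∀ c ∈ gramCone A0 A, 0 ≤ ipr c h := by
    intro c hc
    by_contra! hneg
    have := hfc _ (gramCone_smul hc (div_nonneg_of_nonpos hu.le hneg.le))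
    rw [ipr_smul_left, div_mul_cancel₀ _ hneg.ne] at this
    exact lt_irrefl _ this
  have hmem : h ∈ Gamma A0 A := by
    refine ⟨?_, fun i => ?_, ?_⟩
    · simpa [ipr] using hpos (1, 0)
        (mem_gramCone_of_nonneg ⟨zero_le_one, le_rfl⟩)
    · simpa [ipr] using hpos (0, Pi.single i 1)
        (mem_gramCone_of_nonneg ⟨le_rfl, Pi.single_nonneg.2 zero_le_one⟩)
    · refine PosSemidef.of_dotProduct_mulVec_nonneg ?_ fun y => ?_
      · rw [IsHermitian, conjTranspose_eq_transpose_of_trivial]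
        exact Amix_isSymm hA0 hA _ _
      · rw [star_trivial, ← ipr_quadVec]
        exact hpos _ (quadVec_mem_gramCone y)
  have := hv h hmem
  rw [ipr_neg_left] at hfu
  linarith

end Gram

section Kron

open Kronecker

variable {r k m : ℕ} {A0 : Matrix (Fin r) (Fin r) ℝ} {A : Fin m → Matrix (Fin r) (Fin r) ℝ}

theorem Amix_one_kronecker (g0 : ℝ) (g : Fin m → ℝ) :
    Amix ((1 : Matrix (Fin k) (Fin k) ℝ) ⊗ₖ A0)
        (fun i => (1 : Matrix (Fin k) (Fin k) ℝ) ⊗ₖ A i) g0 g =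
      (1 : Matrix (Fin k) (Fin k) ℝ) ⊗ₖ Amix A0 A g0 g := by
  ext p q
  simp [Amix, Matrix.add_apply, Matrix.sum_apply, Matrix.smul_apply, kroneckerMap_apply,
    mul_add, Finset.mul_sum]
  congr 1
  · ring
  · exact Finset.sum_congr rfl fun _ _ => by ring

theorem tensorVec_dotProduct_kronecker (M : Matrix (Fin r) (Fin r) ℝ) (w : Fin k → ℝ)
    (y : Fin r → ℝ) :
    tensorVec w y ⬝ᵥ ((1 : Matrix (Fin k) (Fin k) ℝ) ⊗ₖ M) *ᵥ tensorVec w y =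
      (w ⬝ᵥ w) * (y ⬝ᵥ M *ᵥ y) := by
  have h : ((1 : Matrix (Fin k) (Fin k) ℝ) ⊗ₖ M) *ᵥ tensorVec w y = tensorVec w (M *ᵥ y) := by
    ext p
    simp only [mulVec, dotProduct, tensorVec, Fintype.sum_prod_type, kroneckerMap_apply,
      Matrix.one_apply, Finset.mul_sum]
    rw [Finset.sum_eq_single p.1]
    · exact Finset.sum_congr rfl fun _ _ => by simp; ring
    · intro a _ ha
      simp [ha.symm]
    · simp
  rw [h]
  simp only [dotProduct, tensorVec, Fintype.sum_prod_type, Finset.sum_mul_sum]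
  exact Finset.sum_congr rfl fun _ _ => Finset.sum_congr rfl fun _ _ => by ring

theorem tensorVec_ne_zero {w : Fin k → ℝ} {y : Fin r → ℝ} (hw : w ≠ 0) (hy : y ≠ 0) :
    tensorVec w y ≠ 0 := by
  obtain ⟨a, ha⟩ := Function.ne_iff.1 hw
  obtain ⟨j, hj⟩ := Function.ne_iff.1 hy
  exact Function.ne_iff.2 ⟨(a, j), mul_ne_zero ha hj⟩

theorem isSymm_one_kronecker {M : Matrix (Fin r) (Fin r) ℝ} (hM : M.IsSymm) :
    ((1 : Matrix (Fin k) (Fin k) ℝ) ⊗ₖ M).IsSymm := by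
  rw [Matrix.IsSymm, ← kroneckerMap_transpose, transpose_one, hM.eq]

theorem posDef_of_one_kronecker [NeZero k] {M : Matrix (Fin r) (Fin r) ℝ} (hsymm : M.IsSymm)
    (h : ((1 : Matrix (Fin k) (Fin k) ℝ) ⊗ₖ M).PosDef) : M.PosDef := by
  refine PosDef.of_dotProduct_mulVec_pos ?_ fun y hy => ?_
  · rw [IsHermitian, conjTranspose_eq_transpose_of_trivial, hsymm.eq]
  · have hw : (Pi.single 0 1 : Fin k → ℝ) ≠ 0 := by simp
    have := h.dotProduct_mulVec_pos (tensorVec_ne_zero hw hy)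
    rw [star_trivial, tensorVec_dotProduct_kronecker] at this
    simpa using this

theorem dotProduct_mulVec_nonneg_of_one_kronecker [NeZero k] {M : Matrix (Fin r) (Fin r) ℝ}
    (h : ((1 : Matrix (Fin k) (Fin k) ℝ) ⊗ₖ M).PosSemidef) (y : Fin r → ℝ) :
    0 ≤ y ⬝ᵥ M *ᵥ y := by
  have := h.dotProduct_mulVec_nonneg (tensorVec (Pi.single 0 1 : Fin k → ℝ) y)
  rw [star_trivial, tensorVec_dotProduct_kronecker] at this
  simpa using this

theorem Gamma_subset_Gamma_one_kronecker :
    Gamma A0 A ⊆ Gamma ((1 : Matrix (Fin k) (Fin k) ℝ) ⊗ₖ A0)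
      (fun i => (1 : Matrix (Fin k) (Fin k) ℝ) ⊗ₖ A i) := by
  rintro f ⟨h0, h1, h2⟩
  refine ⟨h0, h1, ?_⟩
  rw [Amix_one_kronecker]
  exact PosSemidef.one.kronecker h2

theorem neg_sum_quadVec_mem_polarCone [NeZero k] {α : Type*} (T : Finset α)
    (B : α → Fin r → ℝ) {s : ℝ × (Fin m → ℝ)} (hs : 0 ≤ s) :
    -(∑ j ∈ T, quadVec A0 A (B j) + s) ∈
      polarCone (Gamma ((1 : Matrix (Fin k) (Fin k) ℝ) ⊗ₖ A0)
        (fun i => (1 : Matrix (Fin k) (Fin k) ℝ) ⊗ₖ A i)) := by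
  intro f hf
  have h1 := ipr_nonneg hs hf.1 hf.2.1
  have h2 : 0 ≤ ∑ j ∈ T, ipr (quadVec A0 A (B j)) f := Finset.sum_nonneg fun j _ => by
    have h := hf.2.2
    rw [Amix_one_kronecker] at h
    rw [ipr_quadVec]
    exact dotProduct_mulVec_nonneg_of_one_kronecker h _
  rw [ipr_neg_left, ipr_add_left, ipr_sum_left]
  linarith

/-- Along some line in a direction `(w ⊗ y, t')` with `w` a unit vector, `q(x) - 2t e₀` stays in
the span of its initial value and `(yᵀ 𝔸ᵢ y)ᵢ`. -/
theorem exists_rounding_direction (hA0 : A0.IsSymm) (hA : ∀ i, (A i).IsSymm)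
    (b0 : Fin k × Fin r → ℝ) (c0 : ℝ) (b : Fin m → Fin k × Fin r → ℝ) (c : Fin m → ℝ)
    (hkm : m ≤ k) {g : Fin m → ℝ} {x : Fin k × Fin r → ℝ} {t : ℝ} {v : ℝ × (Fin m → ℝ)}
    (hv : qVec ((1 : Matrix (Fin k) (Fin k) ℝ) ⊗ₖ A0) b0 c0
      (fun i => (1 : Matrix (Fin k) (Fin k) ℝ) ⊗ₖ A i) b c x - (2 * t) • e0 = v)
    (hvg : ipr v (1, g) ≤ 0) (hv0 : ¬ v ≤ 0) (y : Fin r → ℝ) :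
    ∃ (w : Fin k → ℝ) (t' l : ℝ), w ⬝ᵥ w = 1 ∧ ∀ a : ℝ,
      qVec ((1 : Matrix (Fin k) (Fin k) ℝ) ⊗ₖ A0) b0 c0
        (fun i => (1 : Matrix (Fin k) (Fin k) ℝ) ⊗ₖ A i) b c (x + a • tensorVec w y) -
          (2 * (t + a * t')) • e0 = (1 + 2 * a * l) • v + a ^ 2 • quadVec A0 A y := by
  let d0 := ((1 : Matrix (Fin k) (Fin k) ℝ) ⊗ₖ A0) *ᵥ x + b0
  let d : Fin m → Fin k × Fin r → ℝ :=
    fun i => ((1 : Matrix (Fin k) (Fin k) ℝ) ⊗ₖ A i) *ᵥ x + b i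
  have tadd : ∀ w w' : Fin k → ℝ, tensorVec (w + w') y = tensorVec w y + tensorVec w' y :=
    fun w w' => funext fun p => by simp [tensorVec, add_mul]
  have tsmul : ∀ (a : ℝ) (w : Fin k → ℝ), tensorVec (a • w) y = a • tensorVec w y :=
    fun a w => funext fun p => by simp [tensorVec, mul_assoc]
  let T : ((Fin k → ℝ) × (ℝ × ℝ)) →ₗ[ℝ] (ℝ × (Fin m → ℝ)) :=
    { toFun := fun z => (d0 ⬝ᵥ tensorVec z.1 y - z.2.1 - z.2.2 * v.1,
        fun i => d i ⬝ᵥ tensorVec z.1 y - z.2.2 * v.2 i)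
      map_add' := fun z z' => by
        ext <;> simp only [Prod.fst_add, Prod.snd_add, tadd, dotProduct_add, Pi.add_apply] <;> ring
      map_smul' := fun a z => by
        ext <;> simp only [Prod.smul_fst, Prod.smul_snd, tsmul, dotProduct_smul, smul_eq_mul,
          Pi.smul_apply, RingHom.id_apply] <;> ring }
  have hker : LinearMap.ker T ≠ ⊥ := LinearMap.ker_ne_bot_of_finrank_lt (by simp; omega)
  obtain ⟨⟨w, t', l⟩, hz, hne⟩ := (Submodule.ne_bot_iff _).1 hker
  rw [LinearMap.mem_ker, Prod.ext_iff] at hz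
  obtain ⟨h0, hi⟩ := hz
  replace h0 : d0 ⬝ᵥ tensorVec w y - t' - l * v.1 = 0 := h0
  replace hi : ∀ i, d i ⬝ᵥ tensorVec w y - l * v.2 i = 0 := fun i => congrFun hi i
  have hw : w ≠ 0 := by
    rintro rfl
    have hz : tensorVec (0 : Fin k → ℝ) y = 0 := funext fun p => by simp [tensorVec]
    simp only [hz, dotProduct_zero, zero_sub, neg_eq_zero, mul_eq_zero] at h0 hi
    rcases eq_or_ne l 0 with rfl | hl
    · apply hne
      have : t' = 0 := by linarith
      rw [this]; rfl
    · have h2 : v.2 = 0 := funext fun i => (hi i).resolve_left hl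
      refine hv0 ⟨?_, h2.le⟩
      simpa [ipr, h2] using hvg
  have hpos : 0 < w ⬝ᵥ w := by simpa using dotProduct_star_self_pos_iff.2 hw
  set n : ℝ := √(w ⬝ᵥ w) with hn
  have hnpos : 0 < n := Real.sqrt_pos.2 hpos
  have hnn : n * n = w ⬝ᵥ w := Real.mul_self_sqrt hpos.le
  have hunit : (n⁻¹ • w) ⬝ᵥ (n⁻¹ • w) = 1 := by
    rw [smul_dotProduct, dotProduct_smul, ← hnn, smul_eq_mul, smul_eq_mul]
    field_simp
  refine ⟨n⁻¹ • w, n⁻¹ * t', n⁻¹ * l, hunit, fun a => ?_⟩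
  have e0' : d0 ⬝ᵥ tensorVec (n⁻¹ • w) y = n⁻¹ * (t' + l * v.1) := by
    rw [tsmul, dotProduct_smul, smul_eq_mul]
    congr 1; linarith
  have ei' : ∀ i, d i ⬝ᵥ tensorVec (n⁻¹ • w) y = n⁻¹ * (l * v.2 i) := fun i => by
    rw [tsmul, dotProduct_smul, smul_eq_mul]
    congr 1; linarith [hi i]
  rw [Prod.ext_iff] at hv
  obtain ⟨hv1, hv2⟩ := hv
  simp only [qVec, e0, Prod.fst_sub, Prod.smul_fst, smul_eq_mul, mul_one] at hv1
  replace hv2 : ∀ i, quadF ((1 : Matrix (Fin k) (Fin k) ℝ) ⊗ₖ A i) (b i) (c i) x = v.2 i :=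
    fun i => by simpa [qVec, e0] using congrFun hv2 i
  ext i
  · simp only [qVec, e0, quadVec, Prod.fst_sub, Prod.smul_fst, Prod.fst_add, smul_eq_mul, mul_one]
    rw [quadF_add_smul (isSymm_one_kronecker hA0), tensorVec_dotProduct_kronecker, hunit]
    change _ + 2 * a * (d0 ⬝ᵥ _) + _ - _ = _
    rw [e0']
    linear_combination hv1
  · simp only [qVec, e0, quadVec, Prod.snd_sub, Prod.smul_snd, Prod.snd_add, smul_eq_mul,
      smul_zero, sub_zero, Pi.add_apply, Pi.smul_apply]
    rw [quadF_add_smul (isSymm_one_kronecker (hA i)), tensorVec_dotProduct_kronecker, hunit]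
    change _ + 2 * a * (d i ⬝ᵥ _) + _ = _
    rw [ei']
    linear_combination hv2 i

theorem mem_convexHull_of_neg_sum_quadVec [NeZero k] (hA0 : A0.IsSymm)
    (hA : ∀ i, (A i).IsSymm)
    (b0 : Fin k × Fin r → ℝ) (c0 : ℝ) (b : Fin m → Fin k × Fin r → ℝ) (c : Fin m → ℝ)
    (hkm : m ≤ k) {g : Fin m → ℝ}
    (hg : ((1, g) : ℝ × (Fin m → ℝ)) ∈ Gamma ((1 : Matrix (Fin k) (Fin k) ℝ) ⊗ₖ A0)
      (fun i => (1 : Matrix (Fin k) (Fin k) ℝ) ⊗ₖ A i))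
    {α : Type*} (T : Finset α) (B : α → Fin r → ℝ) (s : ℝ × (Fin m → ℝ)) (hs : 0 ≤ s)
    (p : (Fin k × Fin r → ℝ) × ℝ)
    (hp : qVec ((1 : Matrix (Fin k) (Fin k) ℝ) ⊗ₖ A0) b0 c0
      (fun i => (1 : Matrix (Fin k) (Fin k) ℝ) ⊗ₖ A i) b c p.1 - (2 * p.2) • e0 =
        -(∑ j ∈ T, quadVec A0 A (B j) + s)) :
    p ∈ convexHull ℝ (Sepi ((1 : Matrix (Fin k) (Fin k) ℝ) ⊗ₖ A0) b0 c0
      (fun i => (1 : Matrix (Fin k) (Fin k) ℝ) ⊗ₖ A i) b c) := by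
  classical
  induction T using Finset.induction_on generalizing B s p with
  | empty =>
    apply subset_convexHull
    rw [mem_Sepi_iff, hp]
    simpa using hs
  | insert j T hj ih =>
    by_cases hS : p ∈ Sepi ((1 : Matrix (Fin k) (Fin k) ℝ) ⊗ₖ A0) b0 c0
      (fun i => (1 : Matrix (Fin k) (Fin k) ℝ) ⊗ₖ A i) b c
    · exact subset_convexHull _ _ hS
    rw [mem_Sepi_iff, hp] at hS
    obtain ⟨w, t', l, -, h⟩ := exists_rounding_direction hA0 hA b0 c0 b c hkm hp
      (neg_sum_quadVec_mem_polarCone _ B hs _ hg) hS (B j)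
    have hroot : ∀ a : ℝ, a ^ 2 = 1 + 2 * a * l →
        p + a • (tensorVec w (B j), t') ∈
          convexHull ℝ (Sepi ((1 : Matrix (Fin k) (Fin k) ℝ) ⊗ₖ A0) b0 c0
            (fun i => (1 : Matrix (Fin k) (Fin k) ℝ) ⊗ₖ A i) b c) := by
      intro a ha
      refine ih (fun i => a • B i) (a ^ 2 • s) (smul_nonneg (sq_nonneg a) hs) _ ?_
      refine (h a).trans ?_
      rw [← ha, Finset.sum_insert hj]
      simp only [quadVec_smul, ← Finset.smul_sum]
      module
    set D : ℝ := √(l ^ 2 + 1) with hD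
    have hDsq : D ^ 2 = l ^ 2 + 1 := Real.sq_sqrt (by positivity)
    have hDpos : 0 < D := Real.sqrt_pos.2 (by positivity)
    have hlt := abs_lt_of_sq_lt_sq (by linarith : l ^ 2 < D ^ 2) hDpos.le
    rw [abs_lt] at hlt
    have h1 := hroot (l + D) (by linear_combination hDsq)
    have h2 := hroot (l - D) (by linear_combination hDsq)
    have hcomb := convex_convexHull ℝ _ h1 h2
      (div_nonneg (by linarith : 0 ≤ D - l) (by linarith : 0 ≤ 2 * D))
      (div_nonneg (by linarith : 0 ≤ D + l) (by linarith : 0 ≤ 2 * D))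
      (by field_simp; ring)
    convert hcomb using 1
    match_scalars <;> field_simp <;> ring

end Kron

open Kronecker in
/-- quadratic matrix programs. If every `Aᵢ = I_k ⊗ 𝔸ᵢ` and
`k ≥ m`, then under dual strict feasibility `R'(x,t)` is nontrivial at every
point of `S_SDP \ S`, and consequently `conv(S) = S_SDP`. -/
theorem stmt18 {r k m : ℕ} (A0' : Matrix (Fin r) (Fin r) ℝ)
    (A' : Fin m → Matrix (Fin r) (Fin r) ℝ)
    (hA0 : A0'.IsSymm) (hA : ∀ i, (A' i).IsSymm)
    (b0 : Fin k × Fin r → ℝ) (c0 : ℝ)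
    (b : Fin m → Fin k × Fin r → ℝ) (c : Fin m → ℝ)
    (hkm : m ≤ k)
    (hdef : ∃ g : Fin m → ℝ, (∀ i, 0 ≤ g i) ∧
      (Amix ((1 : Matrix (Fin k) (Fin k) ℝ) ⊗ₖ A0')
        (fun i => (1 : Matrix (Fin k) (Fin k) ℝ) ⊗ₖ A' i) 1 g).PosDef) :
    (∀ p ∈ SSDP ((1 : Matrix (Fin k) (Fin k) ℝ) ⊗ₖ A0') b0 c0
        (fun i => (1 : Matrix (Fin k) (Fin k) ℝ) ⊗ₖ A' i) b c \
        Sepi ((1 : Matrix (Fin k) (Fin k) ℝ) ⊗ₖ A0') b0 c0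
        (fun i => (1 : Matrix (Fin k) (Fin k) ℝ) ⊗ₖ A' i) b c,
      ∀ G : Set (ℝ × (Fin m → ℝ)),
        IsMinFace
          (polarCone (Gamma ((1 : Matrix (Fin k) (Fin k) ℝ) ⊗ₖ A0')
            (fun i => (1 : Matrix (Fin k) (Fin k) ℝ) ⊗ₖ A' i)))
          (qVec ((1 : Matrix (Fin k) (Fin k) ℝ) ⊗ₖ A0') b0 c0
            (fun i => (1 : Matrix (Fin k) (Fin k) ℝ) ⊗ₖ A' i) b c p.1 -
            (2 * p.2) • e0) G →
        ∃ d ∈ Rset' ((1 : Matrix (Fin k) (Fin k) ℝ) ⊗ₖ A0') b0 c0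
          (fun i => (1 : Matrix (Fin k) (Fin k) ℝ) ⊗ₖ A' i) b c p.1 p.2 G,
          d ≠ 0) ∧
    convexHull ℝ (Sepi ((1 : Matrix (Fin k) (Fin k) ℝ) ⊗ₖ A0') b0 c0
        (fun i => (1 : Matrix (Fin k) (Fin k) ℝ) ⊗ₖ A' i) b c) =
      SSDP ((1 : Matrix (Fin k) (Fin k) ℝ) ⊗ₖ A0') b0 c0
        (fun i => (1 : Matrix (Fin k) (Fin k) ℝ) ⊗ₖ A' i) b c := by
  obtain ⟨g, hg, hpd⟩ := hdef
  have hgΓ : ((1, g) : ℝ × (Fin m → ℝ)) ∈ Gamma ((1 : Matrix (Fin k) (Fin k) ℝ) ⊗ₖ A0')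
      (fun i => (1 : Matrix (Fin k) (Fin k) ℝ) ⊗ₖ A' i) := ⟨zero_le_one, hg, hpd.posSemidef⟩
  rcases Nat.eq_zero_or_pos k with rfl | hk
  · obtain rfl : m = 0 := by omega
    have hsub : SSDP ((1 : Matrix (Fin 0) (Fin 0) ℝ) ⊗ₖ A0') b0 c0
        (fun i => (1 : Matrix (Fin 0) (Fin 0) ℝ) ⊗ₖ A' i) b c ⊆
        Sepi ((1 : Matrix (Fin 0) (Fin 0) ℝ) ⊗ₖ A0') b0 c0
        (fun i => (1 : Matrix (Fin 0) (Fin 0) ℝ) ⊗ₖ A' i) b c := by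
      intro p hp
      rw [mem_Sepi_iff]
      refine ⟨?_, fun i => i.elim0⟩
      simpa [ipr] using hp _ hgΓ
    refine ⟨fun p hp => absurd (hsub hp.1) hp.2, ?_⟩
    exact (convexHull_min (Sepi_subset_SSDP _ _ _ _ _ _) (convex_SSDP _ _ _ _ _ _)).antisymm
      (hsub.trans (subset_convexHull _ _))
  have : NeZero k := ⟨hk.ne'⟩
  have hpd' : (Amix A0' A' 1 g).PosDef := by
    rw [Amix_one_kronecker] at hpd
    exact posDef_of_one_kronecker (Amix_isSymm hA0 hA _ _) hpd
  have hrep : ∀ p ∈ SSDP ((1 : Matrix (Fin k) (Fin k) ℝ) ⊗ₖ A0') b0 c0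
      (fun i => (1 : Matrix (Fin k) (Fin k) ℝ) ⊗ₖ A' i) b c,
      ∃ (B : Fin r → Fin r → ℝ) (s : ℝ × (Fin m → ℝ)), 0 ≤ s ∧
        qVec ((1 : Matrix (Fin k) (Fin k) ℝ) ⊗ₖ A0') b0 c0
          (fun i => (1 : Matrix (Fin k) (Fin k) ℝ) ⊗ₖ A' i) b c p.1 - (2 * p.2) • e0 =
          -(∑ j, quadVec A0' A' (B j) + s) := by
    intro p hp
    obtain ⟨B, s, hs, h⟩ := neg_mem_gramCone_of_mem_polarCone hA0 hA (g := (1, g)) zero_le_one hg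
      hpd' fun f hf => hp f (Gamma_subset_Gamma_one_kronecker hf)
    exact ⟨B, s, hs, neg_eq_iff_eq_neg.1 h⟩
  refine ⟨?_, (convexHull_min (Sepi_subset_SSDP _ _ _ _ _ _)
    (convex_SSDP _ _ _ _ _ _)).antisymm fun p hp => ?_⟩
  · rintro p ⟨hp, hpS⟩ G ⟨⟨-, hface⟩, hvG, -⟩
    obtain ⟨B, s, hs, hv⟩ := hrep p hp
    rw [mem_Sepi_iff] at hpS
    have hB : ∃ j, B j ≠ 0 := by
      by_contra! hB
      apply hpS
      have h0 : quadVec A0' A' 0 = 0 := by ext <;> simp [quadVec]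
      rw [hv]
      simpa [hB, h0] using hs
    obtain ⟨j, hj⟩ := hB
    obtain ⟨w, t', l, hw, h⟩ := exists_rounding_direction hA0 hA b0 c0 b c hkm rfl
      (hp _ hgΓ) hpS (B j)
    have hu : -quadVec A0' A' (B j) ∈ G := by
      refine (hface _ ?_ _
        (neg_sum_quadVec_mem_polarCone (Finset.univ.erase j) B hs) ?_).1
      · simpa using neg_sum_quadVec_mem_polarCone (A0 := A0') (A := A') (k := k) {j} B le_rfl
      · convert hvG using 1
        rw [hv, ← Finset.add_sum_erase _ _ (Finset.mem_univ j)]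
        abel
    refine ⟨(tensorVec w (B j), t'), fun a => ?_, fun h0 => ?_⟩
    · rw [h a]
      refine Submodule.add_mem _ (Submodule.smul_mem _ _ (Submodule.subset_span hvG)) ?_
      rw [← neg_neg (quadVec A0' A' (B j)), smul_neg]
      exact Submodule.neg_mem _ (Submodule.smul_mem _ _ (Submodule.subset_span hu))
    · refine tensorVec_ne_zero ?_ hj (congrArg Prod.fst h0)
      rintro rfl
      simp at hw
  · obtain ⟨B, s, hs, hv⟩ := hrep p hp
    exact mem_convexHull_of_neg_sum_quadVec hA0 hA b0 c0 b c hkm hgΓ Finset.univ B s hs p hv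
end
end
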